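/- Let q₀, q₁, q₂ be unit quaternions, J a symmetric 3×3 real matrix, h > 0, and η ∈ ℝ³. Let q₁(λ) be a differentiable curve of unit quaternions with q₁(0) = q₁ and q₁'(0) = q₁ · (0, η). Then d/dλ |_{λ=0} [ (2/h²)⟨Im(q₀* · q₁(λ)), J Im(q₀* · q₁(λ))⟩ + (2/h²)⟨Im(q₁(λ)* · q₂), J Im(q₁(λ)* · q₂)⟩ ] = (4/h²) ⟨G(q₀* q₁) J Im(q₀* q₁) + G(q₂* q₁) J Im(q₂* q₁), η⟩, where G(p) = p_s I₃ − p̂_v for p = (p_s, p_v). In particular, this derivative vanishes for all η ∈ ℝ³ if and only if G(q₀* q₁) J Im(q₀* q₁) + G(q₂* q₁) J Im(q₂* q₁) = 0. -/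

import Mathlib

open Matrix

noncomputable section

/-- The imaginary part of a quaternion, as a vector in ℝ³. -/
def qim (q : Quaternion ℝ) : Fin 3 → ℝ := ![q.imI, q.imJ, q.imK]

/-- The quaternion with scalar part `s` and vector (imaginary) part `v`. -/
def quat (s : ℝ) (v : Fin 3 → ℝ) : Quaternion ℝ := ⟨s, v 0, v 1, v 2⟩

/-- The hat map sending `x ∈ ℝ³` to the skew-symmetric matrix `x̂` with `x̂ y = x × y`. -/
def hat (x : Fin 3 → ℝ) : Matrix (Fin 3) (Fin 3) ℝ :=
  !![0, -x 2, x 1; x 2, 0, -x 0; -x 1, x 0, 0]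

/-- The map `π : S³ → SO(3)`, `π(q) = (2 qₛ² − 1) I₃ + 2 q_v q_vᵀ + 2 qₛ q̂_v`. -/
def piQ (q : Quaternion ℝ) : Matrix (Fin 3) (Fin 3) ℝ :=
  (2 * q.re ^ 2 - 1) • (1 : Matrix (Fin 3) (Fin 3) ℝ)
    + (2 : ℝ) • Matrix.vecMulVec (qim q) (qim q)
    + (2 * q.re) • hat (qim q)

/-- The matrix `G(q) = qₛ I₃ − q̂_v` with `Im(q·(0,v)) = G(q)ᵀ v`. -/
def Gmat (q : Quaternion ℝ) : Matrix (Fin 3) (Fin 3) ℝ :=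
  q.re • (1 : Matrix (Fin 3) (Fin 3) ℝ) - hat (qim q)

/-- The imaginary part of a quaternion as a continuous linear map. -/
def qimCLM : Quaternion ℝ →L[ℝ] (Fin 3 → ℝ) :=
  LinearMap.toContinuousLinearMap
    { toFun := qim
      map_add' := fun p q => by ext i; fin_cases i <;> simp [qim]
      map_smul' := fun r q => by ext i; fin_cases i <;> simp [qim] }

lemma qim_star (q : Quaternion ℝ) : qim (star q) = -qim q := by
  ext i; fin_cases i <;> simp [qim]

lemma quat_re (s : ℝ) (v : Fin 3 → ℝ) : (quat s v).re = s := rfl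

lemma quat_imI (s : ℝ) (v : Fin 3 → ℝ) : (quat s v).imI = v 0 := rfl

lemma quat_imJ (s : ℝ) (v : Fin 3 → ℝ) : (quat s v).imJ = v 1 := rfl

lemma quat_imK (s : ℝ) (v : Fin 3 → ℝ) : (quat s v).imK = v 2 := rfl

lemma qim_mul_quat_zero (p : Quaternion ℝ) (v : Fin 3 → ℝ) :
    qim (p * quat 0 v) = (Gmat p)ᵀ *ᵥ v := by
  ext i
  fin_cases i <;>
    simp [qim, quat_re, quat_imI, quat_imJ, quat_imK, Gmat, hat, mulVec, dotProduct,
      Fin.sum_univ_three] <;> ring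

/-- Derivative of a quadratic form with symmetric matrix along a curve. -/
lemma HasDerivAt.dotProduct_mulVec_self {n : Type*} [Fintype n] {J : Matrix n n ℝ}
    (hJ : Jᵀ = J) {f : ℝ → n → ℝ} {f' : n → ℝ} {t : ℝ} (hf : HasDerivAt f f' t) :
    HasDerivAt (fun l => f l ⬝ᵥ (J *ᵥ f l)) (2 * ((J *ᵥ f t) ⬝ᵥ f')) t := by
  have hc : ∀ i, HasDerivAt (fun l => f l i) (f' i) t := hasDerivAt_pi.1 hf
  have hJc : ∀ i, HasDerivAt (fun l => (J *ᵥ f l) i) ((J *ᵥ f') i) t := fun i =>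
    HasDerivAt.fun_sum fun j _ => (hc j).const_mul (J i j)
  have key : HasDerivAt (fun l => f l ⬝ᵥ (J *ᵥ f l))
      (∑ i, (f' i * (J *ᵥ f t) i + f t i * (J *ᵥ f') i)) t :=
    HasDerivAt.fun_sum fun i _ => (hc i).mul (hJc i)
  convert key using 1
  have hsymm : f t ⬝ᵥ (J *ᵥ f') = (J *ᵥ f t) ⬝ᵥ f' := by
    rw [dotProduct_mulVec, ← mulVec_transpose, hJ]
  have hcomm : f' ⬝ᵥ (J *ᵥ f t) = (J *ᵥ f t) ⬝ᵥ f' := dotProduct_comm _ _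
  rw [Finset.sum_add_distrib]
  change _ = f' ⬝ᵥ (J *ᵥ f t) + f t ⬝ᵥ (J *ᵥ f')
  rw [hsymm, hcomm, two_mul]

/-- Derivative of the kinetic term of the relative rotation `a * c l`. -/
lemma hasDerivAt_kinetic {J : Matrix (Fin 3) (Fin 3) ℝ} (hJ : Jᵀ = J) (a : Quaternion ℝ)
    {c : ℝ → Quaternion ℝ} {η : Fin 3 → ℝ} {t : ℝ} (hc : HasDerivAt c (c t * quat 0 η) t) :
    HasDerivAt (fun l => qim (a * c l) ⬝ᵥ (J *ᵥ qim (a * c l)))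
      (2 * ((Gmat (a * c t) *ᵥ (J *ᵥ qim (a * c t))) ⬝ᵥ η)) t := by
  have hq : HasDerivAt (fun l => qim (a * c l)) (qim (a * (c t * quat 0 η))) t :=
    qimCLM.hasFDerivAt.comp_hasDerivAt t (hc.const_mul a)
  convert hq.dotProduct_mulVec_self hJ using 2
  rw [← mul_assoc, qim_mul_quat_zero, dotProduct_mulVec, vecMul_transpose]

/-- Every tangent vector to the unit quaternions is the velocity of a curve in them. -/
lemma exists_unit_curve {q : Quaternion ℝ} (hq : ‖q‖ = 1) (η : Fin 3 → ℝ) :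
    ∃ c : ℝ → Quaternion ℝ, (∀ l, ‖c l‖ = 1) ∧ c 0 = q ∧ HasDerivAt c (q * quat 0 η) 0 := by
  refine ⟨fun l => q * NormedSpace.exp (l • quat 0 η), fun l => ?_, by simp, ?_⟩
  · simp [hq, Quaternion.norm_exp, quat_re]
  · simpa using (hasDerivAt_exp_smul_const (𝕂 := ℝ) (quat 0 η) (0 : ℝ)).const_mul q

/-- Derivative of the sum of the two discrete rotational kinetic terms along a
variation of the middle point `q₁`, and the resulting stationarity condition. -/
theorem deriv_discrete_action_middle (q₀ q₁ q₂ : Quaternion ℝ)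
    (h₀ : ‖q₀‖ = 1) (h₁ : ‖q₁‖ = 1) (h₂ : ‖q₂‖ = 1)
    (J : Matrix (Fin 3) (Fin 3) ℝ) (hJ : Jᵀ = J) (h : ℝ) (hh : 0 < h) :
    (∀ (η : Fin 3 → ℝ) (c : ℝ → Quaternion ℝ), (∀ l, ‖c l‖ = 1) → c 0 = q₁ →
        HasDerivAt c (q₁ * quat 0 η) 0 →
        deriv (fun l =>
            2 / h ^ 2 * (qim (star q₀ * c l) ⬝ᵥ (J *ᵥ qim (star q₀ * c l)))
              + 2 / h ^ 2 * (qim (star (c l) * q₂) ⬝ᵥ (J *ᵥ qim (star (c l) * q₂)))) 0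
          = 4 / h ^ 2 * ((Gmat (star q₀ * q₁) *ᵥ (J *ᵥ qim (star q₀ * q₁))
              + Gmat (star q₂ * q₁) *ᵥ (J *ᵥ qim (star q₂ * q₁))) ⬝ᵥ η)) ∧
    ((∀ (η : Fin 3 → ℝ) (c : ℝ → Quaternion ℝ), (∀ l, ‖c l‖ = 1) → c 0 = q₁ →
        HasDerivAt c (q₁ * quat 0 η) 0 →
        deriv (fun l =>
            2 / h ^ 2 * (qim (star q₀ * c l) ⬝ᵥ (J *ᵥ qim (star q₀ * c l)))
              + 2 / h ^ 2 * (qim (star (c l) * q₂) ⬝ᵥ (J *ᵥ qim (star (c l) * q₂)))) 0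
          = 0) ↔
      Gmat (star q₀ * q₁) *ᵥ (J *ᵥ qim (star q₀ * q₁))
        + Gmat (star q₂ * q₁) *ᵥ (J *ᵥ qim (star q₂ * q₁)) = 0) := by
  have main : ∀ (η : Fin 3 → ℝ) (c : ℝ → Quaternion ℝ), c 0 = q₁ →
      HasDerivAt c (q₁ * quat 0 η) 0 →
      deriv (fun l =>
          2 / h ^ 2 * (qim (star q₀ * c l) ⬝ᵥ (J *ᵥ qim (star q₀ * c l)))
            + 2 / h ^ 2 * (qim (star (c l) * q₂) ⬝ᵥ (J *ᵥ qim (star (c l) * q₂)))) 0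
        = 4 / h ^ 2 * ((Gmat (star q₀ * q₁) *ᵥ (J *ᵥ qim (star q₀ * q₁))
            + Gmat (star q₂ * q₁) *ᵥ (J *ᵥ qim (star q₂ * q₁))) ⬝ᵥ η) := by
    rintro η c rfl hc
    have hstar : ∀ l, qim (star (c l) * q₂) = -qim (star q₂ * c l) := fun l => by
      rw [← qim_star, star_mul, star_star]
    simp only [hstar, mulVec_neg, dotProduct_neg, neg_dotProduct, neg_neg]
    rw [(((hasDerivAt_kinetic hJ (star q₀) hc).const_mul (2 / h ^ 2)).fun_add
      ((hasDerivAt_kinetic hJ (star q₂) hc).const_mul (2 / h ^ 2))).deriv, add_dotProduct]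
    ring
  refine ⟨fun η c _ h0 hc => main η c h0 hc, fun hall => ?_, fun hzero η c _ h0 hc => ?_⟩
  · refine dotProduct_eq_zero _ fun η => ?_
    obtain ⟨c, hnorm, h0, hc⟩ := exists_unit_curve h₁ η
    have hz := (main η c h0 hc).symm.trans (hall η c hnorm h0 hc)
    exact (mul_eq_zero.1 hz).resolve_left (by positivity)
  · rw [main η c h0 hc, hzero, zero_dotProduct, mul_zero]
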